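/- arXiv:2012.02808 — 8 statements merged into one kernel-verified Lean document; each statement's English description precedes it below -/
import Mathlib

section
/- Let U, V, W be finite-dimensional real inner product spaces, and let f : U → V and g : V → W be linear maps such that g ∘ f = 0. Define the operator Δ : V → V by Δ = f ∘ f* + g* ∘ g, where * denotes the (Hilbert-space) adjoint. Then the dimension of the kernel of Δ equals dim(ker g) − dim(range f). (In the paper's setting, taking f = ∂_{q+1}^{L,K} and g = ∂_q^K, this says that the nullity of the q-th persistent Laplacian Δ_q^{K,L} equals the q-th persistent Betti number β_q^{K,L} of the simplicial pair K ↪ L.) -/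
open scoped InnerProductSpace in
/-- The kernel of `f ∘ f* + g* ∘ g` consists of the vectors of `ker g` orthogonal to `range f`. -/
theorem LinearMap.ker_comp_adjoint_add_adjoint_comp
    {U V W : Type*}
    [NormedAddCommGroup U] [InnerProductSpace ℝ U] [FiniteDimensional ℝ U]
    [NormedAddCommGroup V] [InnerProductSpace ℝ V] [FiniteDimensional ℝ V]
    [NormedAddCommGroup W] [InnerProductSpace ℝ W] [FiniteDimensional ℝ W]
    (f : U →ₗ[ℝ] V) (g : V →ₗ[ℝ] W) :
    LinearMap.ker (f ∘ₗ LinearMap.adjoint f + LinearMap.adjoint g ∘ₗ g) =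
      (LinearMap.range f)ᗮ ⊓ LinearMap.ker g := by
  have mem_orthogonal (x : V) : x ∈ (LinearMap.range f)ᗮ ↔ LinearMap.adjoint f x = 0 := by
    rw [Submodule.mem_orthogonal]
    constructor
    · intro h
      rw [← inner_self_eq_zero (𝕜 := ℝ), LinearMap.adjoint_inner_right]
      exact h _ (LinearMap.mem_range_self f _)
    · rintro h _ ⟨u, rfl⟩
      rw [← LinearMap.adjoint_inner_right, h, inner_zero_right]
  ext x
  rw [Submodule.mem_inf, mem_orthogonal, LinearMap.mem_ker, LinearMap.mem_ker]
  constructor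
  · intro h
    have hx : ⟪f (LinearMap.adjoint f x) + LinearMap.adjoint g (g x), x⟫_ℝ = 0 := by
      simpa using congrArg (fun y => ⟪y, x⟫_ℝ) h
    rw [inner_add_left, ← LinearMap.adjoint_inner_right f, LinearMap.adjoint_inner_left g,
      add_eq_zero_iff_of_nonneg real_inner_self_nonneg real_inner_self_nonneg] at hx
    simpa only [inner_self_eq_zero] using hx
  · rintro ⟨hf, hg⟩
    simp [hf, hg]

/-- **Persistent Betti numbers from persistent Laplacians.**
If `f : U → V` and `g : V → W` are linear maps between finite-dimensional real inner
product spaces with `g ∘ f = 0`, then the kernel of the "Laplacian"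
`Δ = f ∘ f* + g* ∘ g` has dimension `dim (ker g) − dim (range f)`. -/
theorem persistent_betti_eq_nullity_persistent_laplacian
    {U V W : Type*}
    [NormedAddCommGroup U] [InnerProductSpace ℝ U] [FiniteDimensional ℝ U]
    [NormedAddCommGroup V] [InnerProductSpace ℝ V] [FiniteDimensional ℝ V]
    [NormedAddCommGroup W] [InnerProductSpace ℝ W] [FiniteDimensional ℝ W]
    (f : U →ₗ[ℝ] V) (g : V →ₗ[ℝ] W) (hgf : g ∘ₗ f = 0) :
    Module.finrank ℝ
        (LinearMap.ker (f ∘ₗ LinearMap.adjoint f + LinearMap.adjoint g ∘ₗ g)) =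
      Module.finrank ℝ (LinearMap.ker g) - Module.finrank ℝ (LinearMap.range f) := by
  have hle : LinearMap.range f ≤ LinearMap.ker g := LinearMap.range_le_ker_iff.mpr hgf
  rw [LinearMap.ker_comp_adjoint_add_adjoint_comp,
    ← Submodule.finrank_add_inf_finrank_orthogonal hle, Nat.add_sub_cancel_left]
end

section
/- Let D be a real p×m matrix and let Y be an invertible m×m real matrix such that R := D·Y is column reduced, meaning that for any two nonzero columns of R, the indices of their lowest nonzero entries (the largest row index carrying a nonzero entry) are distinct. Let I ⊆ {1,…,m} be the set of indices of the zero columns of R. Then: (1) if I = ∅ then ker(D) = {0}; (2) if I ≠ ∅ then the columns of Y indexed by I form a basis of ker(D) = {x ∈ ℝᵐ : D·x = 0}. -/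
open Matrix

/-- A vector in the kernel of a column reduced matrix vanishes at the indices of the nonzero
columns. -/
theorem apply_eq_zero_of_mulVec_eq_zero_of_columnReduced {K ι κ : Type*} [Semiring K]
    [NoZeroDivisors K] [LinearOrder ι] [WellFoundedGT ι] [Fintype κ] {R : Matrix ι κ K}
    (hR : ∀ j₁ j₂ : κ, j₁ ≠ j₂ → ∀ i : ι,
      (R i j₁ ≠ 0 ∧ ∀ i' : ι, i < i' → R i' j₁ = 0) →
      ¬(R i j₂ ≠ 0 ∧ ∀ i' : ι, i < i' → R i' j₂ = 0))
    {c : κ → K} (hc : R *ᵥ c = 0) {i : ι} {j : κ} (hij : R i j ≠ 0) : c j = 0 := by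
  induction i using WellFoundedGT.induction generalizing j with
  | ind i ih =>
    by_cases hlow : ∀ i', i < i' → R i' j = 0
    · have hsum : ∑ k, R i k * c k = R i j * c j := by
        refine Finset.sum_eq_single j (fun k _ hkj => ?_) (by simp)
        by_cases hik : R i k = 0
        · rw [hik, zero_mul]
        · have hk := hR j k hkj.symm i ⟨hij, hlow⟩
          push Not at hk
          obtain ⟨i', hi', hne⟩ := hk hik
          rw [ih i' hi' hne, mul_zero]
      have hzero : R i j * c j = 0 := hsum.symm.trans (congrFun hc i)
      exact (mul_eq_zero.mp hzero).resolve_left hij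
    · push Not at hlow
      obtain ⟨i', hi', hne⟩ := hlow
      exact ih i' hi' hne

/-- **Basis of the kernel from column reduction.**
If `Y` is invertible and `R = D·Y` is column reduced (distinct nonzero columns have
distinct lowest-nonzero-entry indices), and `I` is the set of indices of zero columns of
`R`, then: (1) if `I = ∅` then `ker D = {0}`; (2) if `I ≠ ∅` then the columns of `Y`
indexed by `I` form a basis (a linearly independent spanning family) of `ker D`. -/
theorem columns_of_Y_basis_of_ker {p m : ℕ}
    (D : Matrix (Fin p) (Fin m) ℝ) (Y : Matrix (Fin m) (Fin m) ℝ) (hY : IsUnit Y)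
    (R : Matrix (Fin p) (Fin m) ℝ) (hR : R = D * Y)
    (hCR : ∀ j₁ j₂ : Fin m, j₁ ≠ j₂ → ∀ i : Fin p,
      (R i j₁ ≠ 0 ∧ ∀ i' : Fin p, i < i' → R i' j₁ = 0) →
      ¬(R i j₂ ≠ 0 ∧ ∀ i' : Fin p, i < i' → R i' j₂ = 0)) :
    (({j : Fin m | ∀ i : Fin p, R i j = 0} = ∅) →
      ∀ x : Fin m → ℝ, D.mulVec x = 0 → x = 0) ∧
    ({j : Fin m | ∀ i : Fin p, R i j = 0}.Nonempty →
      LinearIndependent ℝ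
        (fun j : {j : Fin m // ∀ i : Fin p, R i j = 0} => fun i : Fin m => Y i j.1) ∧
      Submodule.span ℝ
          (Set.range (fun j : {j : Fin m // ∀ i : Fin p, R i j = 0} =>
            fun i : Fin m => Y i j.1)) =
        LinearMap.ker D.mulVecLin) := by
  have hker : ∀ x : Fin m → ℝ, D *ᵥ x = 0 →
      ∃ c : Fin m → ℝ, Y *ᵥ c = x ∧ ∀ i j, R i j ≠ 0 → c j = 0 := by
    intro x hx
    obtain ⟨c, rfl⟩ := mulVec_surjective_iff_isUnit.mpr hY x
    refine ⟨c, rfl, fun i j hij => apply_eq_zero_of_mulVec_eq_zero_of_columnReduced hCR ?_ hij⟩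
    rw [hR, ← mulVec_mulVec, hx]
  refine ⟨fun hI x hx => ?_, fun _ => ⟨?_, le_antisymm ?_ fun x hx => ?_⟩⟩
  · obtain ⟨c, rfl, hc⟩ := hker x hx
    have hc0 : c = 0 := funext fun j => by
      have hj : ¬∀ i, R i j = 0 := Set.eq_empty_iff_forall_notMem.mp hI j
      push Not at hj
      obtain ⟨i, hij⟩ := hj
      exact hc i j hij
    rw [hc0, mulVec_zero]
  · exact (linearIndependent_cols_iff_isUnit.mpr hY).comp _ Subtype.val_injective
  · rw [Submodule.span_le]
    rintro _ ⟨j, rfl⟩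
    ext i
    exact (congrFun (congrFun hR i) j.1).symm.trans (j.2 i)
  · obtain ⟨c, rfl, hc⟩ := hker x hx
    simp only [mulVec_eq_sum, op_smul_eq_smul]
    refine Submodule.sum_mem _ fun j _ => ?_
    by_cases hj : ∀ i, R i j = 0
    · exact Submodule.smul_mem _ (c j) (Submodule.subset_span ⟨⟨j, hj⟩, rfl⟩)
    · push Not at hj
      obtain ⟨i, hij⟩ := hj
      simp [hc i j hij]
end

section
/- Let B be a real n×m matrix written in row blocks B = [B₁; B₂], where B₁ consists of the first d rows and B₂ of the remaining n−d rows. Let P be the m×m matrix (in the standard basis) of the orthogonal projection of Euclidean ℝᵐ onto the kernel {x ∈ ℝᵐ : B₂·x = 0}. Then for every matrix X with (B₂·B₂ᵀ)·X = B₂·B₁ᵀ, one has B₁·P·B₁ᵀ = B₁·B₁ᵀ − B₁·B₂ᵀ·X. (With B the boundary matrix B_{q+1}^L of a simplicial pair K ↪ L and the row blocks corresponding to q-simplices of K and of L∖K, the left-hand side is the matrix of the up persistent Laplacian Δ_{q,up}^{K,L}, so this is the identity Δ_{q,up}^{K,L} = Δ_{q,up}^L / Δ_{q,up}^L(I_K^L,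 I_K^L) expressing the up persistent Laplacian as a generalized Schur complement.) -/
open Matrix

/-- **The up persistent Laplacian as a generalized Schur complement.**
Let `B = [B₁; B₂]` (row blocks) and let `P` be the matrix of the Euclidean orthogonal
projection of `ℝᵐ` onto `ker B₂` (characterized by: `P` maps into `ker B₂`, fixes
`ker B₂`, and is symmetric). Then for every `X` with `(B₂·B₂ᵀ)·X = B₂·B₁ᵀ` one has
`B₁·P·B₁ᵀ = B₁·B₁ᵀ − B₁·B₂ᵀ·X`, i.e. the up persistent Laplacian equals the generalized
Schur complement of the block `B₂·B₂ᵀ` in `B·Bᵀ`. -/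
theorem up_persistent_laplacian_eq_schur_complement {d e m : ℕ}
    (B₁ : Matrix (Fin d) (Fin m) ℝ) (B₂ : Matrix (Fin e) (Fin m) ℝ)
    (P : Matrix (Fin m) (Fin m) ℝ)
    (hP_range : ∀ x : Fin m → ℝ, B₂.mulVec (P.mulVec x) = 0)
    (hP_fix : ∀ x : Fin m → ℝ, B₂.mulVec x = 0 → P.mulVec x = x)
    (hP_symm : Pᵀ = P)
    (X : Matrix (Fin e) (Fin d) ℝ) (hX : B₂ * B₂ᵀ * X = B₂ * B₁ᵀ) :
    B₁ * P * B₁ᵀ = B₁ * B₁ᵀ - B₁ * B₂ᵀ * X := by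
  have hB₂P : B₂ * P = 0 := by
    refine Matrix.ext_of_mulVec_single fun j => ?_
    rw [← Matrix.mulVec_mulVec, hP_range, Matrix.zero_mulVec]
  have hPB₂ : P * B₂ᵀ = 0 := by
    simpa [Matrix.transpose_mul, hP_symm] using congrArg Matrix.transpose hB₂P
  have hker : B₂ * (B₁ᵀ - B₂ᵀ * X) = 0 := by
    rw [Matrix.mul_sub, ← Matrix.mul_assoc, hX, sub_self]
  have hfix : P * (B₁ᵀ - B₂ᵀ * X) = B₁ᵀ - B₂ᵀ * X := by
    refine Matrix.ext_of_mulVec_single fun j => ?_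
    rw [← Matrix.mulVec_mulVec]
    apply hP_fix
    rw [Matrix.mulVec_mulVec, hker, Matrix.zero_mulVec]
  rw [Matrix.mul_sub, ← Matrix.mul_assoc, hPB₂, Matrix.zero_mul, sub_zero] at hfix
  rw [Matrix.mul_assoc, hfix, Matrix.mul_sub, Matrix.mul_assoc]
end

section
/- Let L be a simple graph on a finite vertex type V, let M := lapMatrix(L) be its combinatorial graph Laplacian over ℝ, let S ⊆ V be a nonempty subset, and let X be any matrix with M(Sᶜ,Sᶜ)·X = M(Sᶜ,S), where M(T,T') denotes the submatrix of M with rows indexed by T and columns by T'. Let N := M(S,S) − M(S,Sᶜ)·X (a square matrix indexed by S); N is the 0-th persistent Laplacian Δ₀^{S,L}. Then the all-ones vector 𝟙_S on S satisfies N·𝟙_S = 0 (so the smallest eigenvalue of N is 0); moreover, if L is connected, then the kernel of N is exactly the one-dimensional span of 𝟙_S (so the second smallest eigenvalue of N is positive). -/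
open Matrix

/-- A matrix-vector product over `V` splits along a finset `S` and its complement. -/
lemma Finset.submatrix_mulVec_add_compl {V ι R : Type*} [Fintype V] [DecidableEq V]
    [NonUnitalNonAssocSemiring R] (M : Matrix V V R) (S : Finset V) (f : ι → V) (x : V → R) :
    M.submatrix f (Subtype.val : ↥S → V) *ᵥ (fun i => x i) +
      M.submatrix f (Subtype.val : ↥Sᶜ → V) *ᵥ (fun i => x i) = fun i => (M *ᵥ x) (f i) := by
  funext i
  simp only [Pi.add_apply, mulVec, dotProduct, submatrix_apply]
  rw [Finset.sum_coe_sort S (fun j => M (f i) j * x j),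
    Finset.sum_coe_sort Sᶜ (fun j => M (f i) j * x j), Finset.sum_add_sum_compl]

/-- If `𝟙` is annihilated by the symmetric block matrix `[A, B; Bᵀ, D]`, then it is annihilated
by the generalized Schur complement of `D`. -/
lemma Matrix.sub_mul_mulVec_one_eq_zero {m n R : Type*} [Fintype m] [Fintype n] [CommRing R]
    {A : Matrix m m R} {B : Matrix m n R} {D : Matrix n n R} {X : Matrix n m R}
    (hD : D.IsSymm) (hX : D * X = Bᵀ) (hA : A *ᵥ 1 + B *ᵥ 1 = 0) (hB : Bᵀ *ᵥ 1 + D *ᵥ 1 = 0) :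
    (A - B * X) *ᵥ 1 = 0 := by
  have hB' : B = Xᵀ * D := by
    rw [← transpose_transpose B, ← hX, transpose_mul, hD.eq]
  have key : (B * X) *ᵥ 1 = -(B *ᵥ 1) := by
    rw [hB', Matrix.mul_assoc, hX, ← mulVec_mulVec, eq_neg_of_add_eq_zero_left hB, mulVec_neg,
      mulVec_mulVec]
  rw [sub_mulVec, key, sub_neg_eq_add, hA]

/-- A vector in the kernel of the generalized Schur complement of `M(Sᶜ,Sᶜ)` extends by `-X v`
to a vector in the kernel of `M`. -/
lemma Matrix.mulVec_extend_eq_zero {V R : Type*} [Fintype V] [DecidableEq V] [CommRing R]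
    {M : Matrix V V R} {S : Finset V} {X : Matrix ↥Sᶜ ↥S R}
    (hX : M.submatrix (Subtype.val : ↥Sᶜ → V) (Subtype.val : ↥Sᶜ → V) * X =
      M.submatrix (Subtype.val : ↥Sᶜ → V) (Subtype.val : ↥S → V))
    {v : ↥S → R}
    (hv : (M.submatrix (Subtype.val : ↥S → V) (Subtype.val : ↥S → V) -
      M.submatrix (Subtype.val : ↥S → V) (Subtype.val : ↥Sᶜ → V) * X) *ᵥ v = 0) :
    ∃ x : V → R, (∀ i : ↥S, x i = v i) ∧ M *ᵥ x = 0 := by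
  let x : V → R := fun i =>
    if h : i ∈ S then v ⟨i, h⟩ else -(X *ᵥ v) ⟨i, Finset.mem_compl.2 h⟩
  have hxS : (fun i : ↥S => x i) = v := by
    funext i
    simp [x]
  have hxC : (fun i : ↥Sᶜ => x i) = -(X *ᵥ v) := by
    funext i
    simp [x, Finset.mem_compl.1 i.2]
  refine ⟨x, congrFun hxS, ?_⟩
  funext i
  by_cases hi : i ∈ S
  · have h := Finset.submatrix_mulVec_add_compl M S (Subtype.val : ↥S → V) x
    rw [hxS, hxC, mulVec_neg, mulVec_mulVec, ← sub_eq_add_neg, ← sub_mulVec, hv] at h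
    exact (congrFun h ⟨i, hi⟩).symm
  · have h := Finset.submatrix_mulVec_add_compl M S (Subtype.val : ↥Sᶜ → V) x
    rw [hxS, hxC, mulVec_neg, mulVec_mulVec, hX, add_neg_cancel] at h
    exact (congrFun h ⟨i, Finset.mem_compl.2 hi⟩).symm

/-- For a simple graph `L` with Laplacian `M = lapMatrix L`, a nonempty vertex subset
`S`, and `N := M(S,S) − M(S,Sᶜ)·X` the 0-th persistent Laplacian `Δ₀^{S,L}` (the
generalized Schur complement of `M(Sᶜ,Sᶜ)` in `M`, where `X` solves
`M(Sᶜ,Sᶜ)·X = M(Sᶜ,S)`): the all-ones vector on `S` lies in the kernel of `N`, and if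
`L` is connected the kernel of `N` is exactly the span of the all-ones vector. -/
theorem persistent_laplacian_ker_all_ones {V : Type*} [Fintype V] [DecidableEq V]
    (L : SimpleGraph V) [DecidableRel L.Adj]
    (S : Finset V) (hS : S.Nonempty)
    (X : Matrix ↥Sᶜ ↥S ℝ)
    (hX : (L.lapMatrix ℝ).submatrix (Subtype.val : ↥Sᶜ → V) (Subtype.val : ↥Sᶜ → V) * X =
        (L.lapMatrix ℝ).submatrix (Subtype.val : ↥Sᶜ → V) (Subtype.val : ↥S → V))
    (N : Matrix ↥S ↥S ℝ)
    (hN : N = (L.lapMatrix ℝ).submatrix (Subtype.val : ↥S → V) (Subtype.val : ↥S → V) -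
        (L.lapMatrix ℝ).submatrix (Subtype.val : ↥S → V) (Subtype.val : ↥Sᶜ → V) * X) :
    N.mulVec (fun _ => 1) = 0 ∧
    (L.Connected →
      LinearMap.ker N.mulVecLin = Submodule.span ℝ {(fun _ => 1 : ↥S → ℝ)}) := by
  subst hN
  have ones (T : Finset V) := Finset.submatrix_mulVec_add_compl (L.lapMatrix ℝ) S
    (Subtype.val : ↥T → V) (fun _ => 1)
  simp only [L.lapMatrix_mulVec_const_eq_zero (R := ℝ)] at ones
  have hsymm : (L.lapMatrix ℝ)ᵀ = L.lapMatrix ℝ := (L.isSymm_lapMatrix (R := ℝ)).eq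
  have h_one := Matrix.sub_mul_mulVec_one_eq_zero
    (B := (L.lapMatrix ℝ).submatrix (Subtype.val : ↥S → V) (Subtype.val : ↥Sᶜ → V))
    ((L.isSymm_lapMatrix (R := ℝ)).submatrix (Subtype.val : ↥Sᶜ → V))
    (by rw [hX, transpose_submatrix, hsymm]) (ones S)
    (by rw [transpose_submatrix, hsymm]; exact ones Sᶜ)
  refine ⟨h_one, fun hL => le_antisymm (fun v hv => ?_) ?_⟩
  · obtain ⟨x, hx, hMx⟩ := Matrix.mulVec_extend_eq_zero hX hv
    obtain ⟨s, hs⟩ := hS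
    refine Submodule.mem_span_singleton.2 ⟨x s, funext fun i => ?_⟩
    simpa [← hx i] using
      (L.lapMatrix_mulVec_eq_zero_iff_forall_reachable.1 hMx) s i (hL.preconnected s i)
  · rw [Submodule.span_le, Set.singleton_subset_iff]
    exact h_one
end

section
/- Let L be a simple graph on a finite vertex type V, let M := lapMatrix(L) be its combinatorial graph Laplacian over ℝ, let S ⊆ V be a nonempty subset, and let X be any matrix with M(Sᶜ,Sᶜ)·X = M(Sᶜ,S). Let N := M(S,S) − M(S,Sᶜ)·X. Then the dimension of the kernel of N (the multiplicity of the eigenvalue 0 of the 0-th persistent Laplacian Δ₀^{S,L}) equals the number of connected components of L that contain at least one vertex of S. -/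
open Matrix

section SchurComplement

variable {V : Type*} [Fintype V] [DecidableEq V] {S : Finset V}

/-- The extension of a vector `y` on `S` by `-X y` on the complement of `S`. -/
def schurExtension (X : Matrix ↥Sᶜ ↥S ℝ) (y : ↥S → ℝ) (v : V) : ℝ :=
  if h : v ∈ S then y ⟨v, h⟩ else -(X *ᵥ y) ⟨v, Finset.mem_compl.2 h⟩

lemma schurExtension_of_mem (X : Matrix ↥Sᶜ ↥S ℝ) (y : ↥S → ℝ) (s : ↥S) :
    schurExtension X y s = y s := by
  simp [schurExtension]

lemma schurExtension_of_mem_compl (X : Matrix ↥Sᶜ ↥S ℝ) (y : ↥S → ℝ) (t : ↥Sᶜ) :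
    schurExtension X y t = -(X *ᵥ y) t := by
  simp [schurExtension, Finset.mem_compl.1 t.2]

lemma submatrix_mulVec_schurExtension {ι : Type*} (M : Matrix V V ℝ) (X : Matrix ↥Sᶜ ↥S ℝ)
    (f : ι → V) (y : ↥S → ℝ) (i : ι) :
    (M *ᵥ schurExtension X y) (f i) =
      ((M.submatrix f (Subtype.val : ↥S → V) -
        M.submatrix f (Subtype.val : ↥Sᶜ → V) * X) *ᵥ y) i := by
  rw [sub_mulVec, ← mulVec_mulVec, Pi.sub_apply]
  simp only [mulVec, dotProduct, submatrix_apply]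
  rw [← Finset.sum_add_sum_compl S, ← Finset.sum_coe_sort S, ← Finset.sum_coe_sort Sᶜ]
  simp only [schurExtension_of_mem, schurExtension_of_mem_compl, mulVec, dotProduct, mul_neg,
    Finset.sum_neg_distrib, sub_eq_add_neg]

/-- For a positive semidefinite matrix `M`, the kernel of the generalized Schur complement consists
of the restrictions to `S` of the vectors in the kernel of `M`. -/
lemma schurComplement_mulVec_eq_zero_iff {M : Matrix V V ℝ} (hM : M.PosSemidef)
    {X : Matrix ↥Sᶜ ↥S ℝ}
    (hX : M.submatrix (Subtype.val : ↥Sᶜ → V) (Subtype.val : ↥Sᶜ → V) * X =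
      M.submatrix (Subtype.val : ↥Sᶜ → V) (Subtype.val : ↥S → V)) (y : ↥S → ℝ) :
    (M.submatrix (Subtype.val : ↥S → V) (Subtype.val : ↥S → V) -
        M.submatrix (Subtype.val : ↥S → V) (Subtype.val : ↥Sᶜ → V) * X) *ᵥ y = 0 ↔
      ∃ w : V → ℝ, M *ᵥ w = 0 ∧ ∀ s : ↥S, w s = y s := by
  have hcompl : ∀ v ∉ S, (M *ᵥ schurExtension X y) v = 0 := fun v hv ↦ by
    have := submatrix_mulVec_schurExtension M X (Subtype.val : ↥Sᶜ → V) y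
      ⟨v, Finset.mem_compl.2 hv⟩
    simpa [hX] using this
  constructor
  · refine fun h ↦ ⟨schurExtension X y, funext fun v ↦ ?_, schurExtension_of_mem X y⟩
    by_cases hv : v ∈ S
    · exact (submatrix_mulVec_schurExtension M X Subtype.val y ⟨v, hv⟩).trans (congrFun h _)
    · exact hcompl v hv
  · rintro ⟨w, hw, hwy⟩
    have hz : M *ᵥ schurExtension X y = M *ᵥ (schurExtension X y - w) := by
      rw [mulVec_sub, hw, sub_zero]
    have h0 : M *ᵥ (schurExtension X y - w) = 0 := by
      rw [← hM.dotProduct_mulVec_zero_iff, star_trivial, ← hz]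
      refine Finset.sum_eq_zero fun v _ ↦ ?_
      by_cases hv : v ∈ S
      · have := schurExtension_of_mem X y ⟨v, hv⟩
        simp_all
      · rw [hcompl v hv, mul_zero]
    funext s
    rw [← submatrix_mulVec_schurExtension, hz, h0]
    rfl

end SchurComplement

/-- The space of functions on a set `S` of vertices that extend to functions constant on
connected components has dimension the number of components meeting `S`. -/
lemma finrank_eq_ncard_components_meeting {V : Type*} [Finite V] (L : SimpleGraph V)
    (S : Finset V) (K : Submodule ℝ (↥S → ℝ))
    (hK : ∀ y, y ∈ K ↔ ∃ w : V → ℝ, (∀ i j, L.Reachable i j → w i = w j) ∧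
      ∀ s : ↥S, w s = y s) :
    Module.finrank ℝ K =
      Set.ncard {c : L.ConnectedComponent | ∃ v ∈ S, L.connectedComponentMk v = c} := by
  classical
  set C := {c : L.ConnectedComponent | ∃ v ∈ S, L.connectedComponentMk v = c}
  have : Fintype C := Fintype.ofFinite C
  let f : ↥S → C := fun s ↦ ⟨L.connectedComponentMk s, s, s.2, rfl⟩
  have hf : Function.Surjective f := by
    rintro ⟨_, v, hv, rfl⟩
    exact ⟨⟨v, hv⟩, rfl⟩
  have hrange : K = LinearMap.range (LinearMap.funLeft ℝ ℝ f) := by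
    ext y
    rw [hK, LinearMap.mem_range]
    constructor
    · rintro ⟨w, hw, hwy⟩
      refine ⟨fun c ↦ c.1.lift w fun i j p _ ↦ hw i j p.reachable, funext hwy⟩
    · rintro ⟨g, rfl⟩
      refine ⟨fun v ↦ if h : L.connectedComponentMk v ∈ C then g ⟨_, h⟩ else 0, ?_, ?_⟩
      · intro i j hij
        simp only [SimpleGraph.ConnectedComponent.sound hij]
      · intro s
        exact dif_pos (f s).2
  rw [hrange, LinearMap.finrank_range_of_inj (LinearMap.funLeft_injective_of_surjective ℝ ℝ f hf),
    Module.finrank_fintype_fun_eq_card, ← Nat.card_eq_fintype_card, Nat.card_coe_set_eq]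

/-- The multiplicity of the eigenvalue `0` of the 0-th persistent Laplacian
`Δ₀^{S,L} = N := M(S,S) − M(S,Sᶜ)·X` (the generalized Schur complement of `M(Sᶜ,Sᶜ)` in
the graph Laplacian `M = lapMatrix L`, where `X` solves `M(Sᶜ,Sᶜ)·X = M(Sᶜ,S)`) equals
the number of connected components of `L` containing at least one vertex of `S`. -/
theorem persistent_laplacian_nullity_eq_card_components_meeting
    {V : Type*} [Fintype V] [DecidableEq V]
    (L : SimpleGraph V) [DecidableRel L.Adj]
    (S : Finset V) (hS : S.Nonempty)
    (X : Matrix ↥Sᶜ ↥S ℝ)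
    (hX : (L.lapMatrix ℝ).submatrix (Subtype.val : ↥Sᶜ → V) (Subtype.val : ↥Sᶜ → V) * X =
        (L.lapMatrix ℝ).submatrix (Subtype.val : ↥Sᶜ → V) (Subtype.val : ↥S → V))
    (N : Matrix ↥S ↥S ℝ)
    (hN : N = (L.lapMatrix ℝ).submatrix (Subtype.val : ↥S → V) (Subtype.val : ↥S → V) -
        (L.lapMatrix ℝ).submatrix (Subtype.val : ↥S → V) (Subtype.val : ↥Sᶜ → V) * X) :
    Module.finrank ℝ (LinearMap.ker N.mulVecLin) =
      Set.ncard {c : L.ConnectedComponent | ∃ v ∈ S, L.connectedComponentMk v = c} := by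
  refine finrank_eq_ncard_components_meeting L S _ fun y ↦ ?_
  rw [LinearMap.mem_ker, mulVecLin_apply, hN,
    schurComplement_mulVec_eq_zero_iff (L.posSemidef_lapMatrix ℝ) hX]
  simp only [L.lapMatrix_mulVec_eq_zero_iff_forall_reachable]
end

section
/- Let M be a real symmetric positive semidefinite matrix indexed by a finite set E, let I ⊊ E be a proper subset, and let i ∈ E∖I be an index such that M(i,j) = 0 for every j ∈ I. Let X be any matrix with M(I,I)·X = M(I,Iᶜ) and set N := M(Iᶜ,Iᶜ) − M(Iᶜ,I)·X, a matrix indexed by Iᶜ = E∖I. Then for every vector c ∈ ℝ^E, the i-th entry of N·(c restricted to Iᶜ) equals the i-th entry of M·c. (With M = Δ_{q,up}^L and Iᶜ indexing the q-simplices of K, this is the statement that for an interior q-simplex σ of K, ⟨Δ_{q,up}^L c^L, [σ]⟩ = ⟨Δ_{q,up}^{K,L} c^K, [σ]⟩, where c^K is the orthogonal projection of c^L to C_q^K.) -/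
open Matrix

/-- **Behavior of the (up persistent) Laplacian on interior simplices.**
Let `M` be a symmetric positive semidefinite matrix indexed by a finite set `E`, let
`I ⊊ E`, and let `i ∉ I` be an index with `M i j = 0` for every `j ∈ I`. Let
`N := M(Iᶜ,Iᶜ) − M(Iᶜ,I)·X` be the generalized Schur complement of `M(I,I)` in `M`,
where `X` solves `M(I,I)·X = M(I,Iᶜ)`. Then for every vector `c`, the `i`-th entry of
`N · (c restricted to Iᶜ)` equals the `i`-th entry of `M · c`. -/
theorem schur_complement_entry_of_interior_index
    {E : Type*} [Fintype E] [DecidableEq E]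
    (M : Matrix E E ℝ) (hM : M.PosSemidef)
    (I : Finset E) (hI : I ≠ Finset.univ)
    (i : E) (hiI : i ∉ I) (hzero : ∀ j ∈ I, M i j = 0)
    (X : Matrix ↥I ↥Iᶜ ℝ)
    (hX : M.submatrix (Subtype.val : ↥I → E) (Subtype.val : ↥I → E) * X =
        M.submatrix (Subtype.val : ↥I → E) (Subtype.val : ↥Iᶜ → E))
    (N : Matrix ↥Iᶜ ↥Iᶜ ℝ)
    (hN : N = M.submatrix (Subtype.val : ↥Iᶜ → E) (Subtype.val : ↥Iᶜ → E) -
        M.submatrix (Subtype.val : ↥Iᶜ → E) (Subtype.val : ↥I → E) * X)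
    (c : E → ℝ) :
    N.mulVec (fun j : ↥Iᶜ => c j.1) ⟨i, Finset.mem_compl.mpr hiI⟩ = M.mulVec c i := by
  have hrow : ∀ j : ↥Iᶜ, N ⟨i, Finset.mem_compl.mpr hiI⟩ j = M i j := by
    intro j
    rw [hN, Matrix.sub_apply, Matrix.mul_apply, Finset.sum_eq_zero, sub_zero,
      Matrix.submatrix_apply]
    intro k _
    rw [Matrix.submatrix_apply, hzero k k.2, zero_mul]
  have hI_sum : ∑ j ∈ I, M i j * c j = 0 :=
    Finset.sum_eq_zero fun j hj => by rw [hzero j hj, zero_mul]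
  simp only [Matrix.mulVec, dotProduct, hrow]
  rw [← Finset.sum_add_sum_compl I, hI_sum, zero_add]
  exact Finset.sum_coe_sort Iᶜ fun j => M i j * c j
end

section
/- Let L be a connected simple graph on a finite vertex type V and let M := lapMatrix(L). Let v ≠ w be two distinct vertices. Then for every vector u ∈ ℝ^V with M·u = e_w − e_v, the effective resistance R_{v,w}^L = (e_w − e_v) ⬝ u satisfies R_{v,w}^L ≥ 1 / |P_L(v,w)|, where |P_L(v,w)| is the number of L-trails from v to w. -/
open Matrix

namespace SimpleGraph

variable {V : Type*}

/-- The walks from `x` to `w` along which `u` is strictly increasing. -/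
def increasingWalks (L : SimpleGraph V) (u : V → ℝ) (w x : V) : Set (L.Walk x w) :=
  {p | p.support.Pairwise (fun a b => u a < u b)}

theorem isTrail_of_mem_increasingWalks {L : SimpleGraph V} {u : V → ℝ} {w x : V}
    {p : L.Walk x w} (hp : p ∈ L.increasingWalks u w x) : p.IsTrail := by
  refine Walk.IsPath.isTrail ?_
  rw [Walk.isPath_def]
  exact List.Pairwise.imp (fun h => ne_of_apply_ne u h.ne) hp

theorem cons_mem_increasingWalks {L : SimpleGraph V} {u : V → ℝ} {w x y : V}
    (h : L.Adj x y) (hxy : u x < u y) {p : L.Walk y w} (hp : p ∈ L.increasingWalks u w y) :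
    Walk.cons h p ∈ L.increasingWalks u w x := by
  have hp' : p.support.Pairwise (fun a b => u a < u b) := hp
  change (Walk.cons h p).support.Pairwise _
  rw [Walk.support_cons, List.pairwise_cons]
  refine ⟨fun z hz => ?_, hp⟩
  rw [← Walk.cons_tail_support, List.pairwise_cons] at hp'
  rw [← Walk.cons_tail_support, List.mem_cons] at hz
  rcases hz with rfl | hz
  · exact hxy
  · exact hxy.trans (hp'.1 z hz)

theorem le_of_mem_increasingWalks {L : SimpleGraph V} {u : V → ℝ} {w x : V} {p : L.Walk x w}
    (hp : p ∈ L.increasingWalks u w x) : u x ≤ u w := by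
  have hp' : p.support.Pairwise (fun a b => u a < u b) := hp
  rw [← Walk.cons_tail_support, List.pairwise_cons] at hp'
  have hw := p.end_mem_support
  rw [← Walk.cons_tail_support, List.mem_cons] at hw
  rcases hw with rfl | hw
  · exact le_rfl
  · exact (hp'.1 w hw).le

variable [Fintype V] [DecidableEq V] (L : SimpleGraph V) [DecidableRel L.Adj]

theorem finite_setOf_isTrail (v w : V) : {p : L.Walk v w | p.IsTrail}.Finite := by
  refine (Set.toFinite {p : L.Walk v w | p.length < L.edgeFinset.card + 1}).subset fun p hp => ?_
  exact Nat.lt_succ_of_le (Walk.IsTrail.length_le_card_edgeFinset hp)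

theorem finite_increasingWalks (u : V → ℝ) (w x : V) : (L.increasingWalks u w x).Finite :=
  (L.finite_setOf_isTrail x w).subset fun _ => isTrail_of_mem_increasingWalks

theorem sum_card_increasingWalks_le (u : V → ℝ) (w x : V) :
    ∑ y with L.Adj x y ∧ u x < u y, (L.increasingWalks u w y).ncard ≤
      (L.increasingWalks u w x).ncard := by
  have hfin := L.finite_increasingWalks u w
  have (y : V) : Finite (L.increasingWalks u w y) := hfin y
  let f : (Σ y : {y // L.Adj x y ∧ u x < u y}, L.increasingWalks u w y.1) →
      L.increasingWalks u w x := fun q =>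
    ⟨Walk.cons q.1.2.1 q.2.1, cons_mem_increasingWalks q.1.2.1 q.1.2.2 q.2.2⟩
  have hf : Function.Injective f := by
    rintro ⟨⟨y, hy⟩, p, hp⟩ ⟨⟨z, hz⟩, q, hq⟩ h
    simp only [f, Subtype.mk.injEq, Walk.cons.injEq] at h
    obtain ⟨rfl, h⟩ := h
    obtain rfl := eq_of_heq h
    rfl
  have := Nat.card_le_card_of_injective f hf
  rw [Nat.card_sigma] at this
  simp only [Nat.card_coe_set_eq] at this
  refine le_of_eq_of_le ?_ this
  exact Finset.sum_subtype _ (by simp) _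

/-- The net current leaving `x` splits into what flows up and what arrives from below. -/
theorem lapMatrix_mulVec_eq_sub (u : V → ℝ) (x : V) :
    (L.lapMatrix ℝ *ᵥ u) x =
      ∑ y with L.Adj x y ∧ u y < u x, (u x - u y) -
        ∑ y with L.Adj x y ∧ u x < u y, (u y - u x) := by
  rw [lapMatrix_mulVec_apply, ← card_neighborFinset_eq_degree, ← nsmul_eq_mul,
    ← Finset.sum_const, ← Finset.sum_sub_distrib, neighborFinset_eq_filter,
    Finset.sum_filter, Finset.sum_filter, Finset.sum_filter, ← Finset.sum_sub_distrib]
  refine Finset.sum_congr rfl fun y _ => ?_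
  rcases lt_trichotomy (u x) (u y) with h | h | h
  · simp [h, h.not_gt]; split_ifs <;> ring
  · simp [h]
  · simp [h, h.not_gt]

/-- The current flowing up out of `x` is at most the number of increasing walks to `w` times the
potential difference to `w`, if no current enters or leaves the network at vertices above `x`
other than `w`. -/
theorem sum_sub_le_card_increasingWalks_mul {u : V → ℝ} {w x : V}
    (hu : ∀ y, u x < u y → y ≠ w → (L.lapMatrix ℝ *ᵥ u) y = 0) :
    ∑ y with L.Adj x y ∧ u x < u y, (u y - u x) ≤
      (L.increasingWalks u w x).ncard * (u w - u x) := by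
  have : IsTrans V (fun a b => u b < u a) := ⟨fun _ _ _ hab hbc => hbc.trans hab⟩
  have : Std.Irrefl (fun a b : V => u b < u a) := ⟨fun a => lt_irrefl (u a)⟩
  induction x using (Finite.wellFounded_of_trans_of_irrefl (fun a b : V => u b < u a)).induction with
  | h x ih =>
    calc ∑ y with L.Adj x y ∧ u x < u y, (u y - u x)
        ≤ ∑ y with L.Adj x y ∧ u x < u y, ((L.increasingWalks u w y).ncard : ℝ) * (u w - u x) := by
          refine Finset.sum_le_sum fun y hy => ?_
          obtain ⟨hadj, hxy⟩ := (Finset.mem_filter.1 hy).2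
          by_cases hyw : y = w
          · subst hyw
            refine le_mul_of_one_le_left (sub_nonneg.2 hxy.le) ?_
            exact_mod_cast (Set.ncard_pos (L.finite_increasingWalks u y y)).2
              ⟨Walk.nil, List.pairwise_singleton _ _⟩
          have hcons := L.lapMatrix_mulVec_eq_sub u y
          rw [hu y hxy hyw] at hcons
          have hin : u y - u x ≤ ∑ z with L.Adj y z ∧ u z < u y, (u y - u z) :=
            Finset.single_le_sum (f := fun z => u y - u z)
              (fun z hz => sub_nonneg.2 (Finset.mem_filter.1 hz).2.2.le)
              (Finset.mem_filter.2 ⟨Finset.mem_univ x, hadj.symm, hxy⟩)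
          have hout := ih y hxy fun z hz => hu z (hxy.trans hz)
          have hmono : ((L.increasingWalks u w y).ncard : ℝ) * (u w - u y) ≤
              (L.increasingWalks u w y).ncard * (u w - u x) := by gcongr
          linarith
      _ ≤ (L.increasingWalks u w x).ncard * (u w - u x) := by
          rw [← Finset.sum_mul]
          have hcard : ∑ y with L.Adj x y ∧ u x < u y, ((L.increasingWalks u w y).ncard : ℝ) ≤
              (L.increasingWalks u w x).ncard := by
            exact_mod_cast L.sum_card_increasingWalks_le u w x
          rcases (L.increasingWalks u w x).eq_empty_or_nonempty with hempty | ⟨p, hp⟩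
          · rw [hempty, Set.ncard_empty, Nat.cast_zero] at hcard ⊢
            rw [le_antisymm hcard (Finset.sum_nonneg fun _ _ => Nat.cast_nonneg _)]
          · exact mul_le_mul_of_nonneg_right hcard
              (sub_nonneg.2 (le_of_mem_increasingWalks hp))

end SimpleGraph

/-- **Lower bound on effective resistance by the number of trails.**
For a connected graph `L` and distinct vertices `v, w`, the effective resistance
`R_{v,w}^L = (e_w − e_v) ⬝ u` (for any solution `u` of `M·u = e_w − e_v`, with
`M = lapMatrix L`) is at least the reciprocal of the number of `L`-trails from `v`
to `w`. -/
theorem effective_resistance_ge_inv_card_trails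
    {V : Type*} [Fintype V] [DecidableEq V]
    (L : SimpleGraph V) [DecidableRel L.Adj] (hL : L.Connected)
    (v w : V) (hvw : v ≠ w)
    (u : V → ℝ) (hu : (L.lapMatrix ℝ).mulVec u = Pi.single w 1 - Pi.single v 1) :
    (Pi.single w 1 - Pi.single v 1) ⬝ᵥ u ≥
      1 / ({p : L.Walk v w | p.IsTrail}.ncard : ℝ) := by
  have hharm : ∀ y, u v < u y → y ≠ w → (L.lapMatrix ℝ *ᵥ u) y = 0 := by
    intro y hy hyw
    have hyv : y ≠ v := ne_of_apply_ne u hy.ne'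
    simp [hu, hyw, hyv]
  have hflow := L.sum_sub_le_card_increasingWalks_mul hharm
  have hv := L.lapMatrix_mulVec_eq_sub u v
  have hin : 0 ≤ ∑ y with L.Adj v y ∧ u y < u v, (u v - u y) :=
    Finset.sum_nonneg fun y hy => sub_nonneg.2 (Finset.mem_filter.1 hy).2.2.le
  rw [hu] at hv
  simp only [Pi.sub_apply, Pi.single_eq_same, Pi.single_eq_of_ne hvw] at hv
  have hone : 1 ≤ ((L.increasingWalks u w v).ncard : ℝ) * (u w - u v) := by linarith
  have hpos : 0 < u w - u v :=
    pos_of_mul_pos_right (one_pos.trans_le hone) (Nat.cast_nonneg _)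
  have hcard : ((L.increasingWalks u w v).ncard : ℝ) ≤ {p : L.Walk v w | p.IsTrail}.ncard := by
    exact_mod_cast Set.ncard_le_ncard
      (fun _ => SimpleGraph.isTrail_of_mem_increasingWalks) (L.finite_setOf_isTrail v w)
  rw [sub_dotProduct, single_one_dotProduct, single_one_dotProduct, ge_iff_le]
  have hbound := hone.trans (mul_le_mul_of_nonneg_right hcard hpos.le)
  exact div_le_of_le_mul₀ (Nat.cast_nonneg _) hpos.le (by rwa [mul_comm])
end

section
/- (The persistent Laplacian preserves effective resistances.) Let L be a connected simple graph on a finite vertex type V, let M := lapMatrix(L), let S ⊆ V and let v ≠ w be two vertices belonging to S. Let X be any matrix with M(Sᶜ,Sᶜ)·X = M(Sᶜ,S) and N := M(S,S) − M(S,Sᶜ)·X, the 0-th persistent Laplacian Δ₀^{S,L}. Set d := e_w − e_v ∈ ℝ^V and let d_S ∈ ℝ^S be its restriction to S. Then for every u ∈ ℝ^V with M·u = d and every u' ∈ ℝ^S with N·u' = d_S, one has d ⬝ u = d_S ⬝ u'; that is, the effective resistance between v and w computed from the persistent Laplacian N equals the effective resistance R_{v,w}^L computed in the full graph L. -/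
open Matrix

section SchurComplement

variable {V R : Type*} [Fintype V] [DecidableEq V] [CommRing R]

/-- A vector on `S`, extended to `Sᶜ` by the values of a second vector. -/
def glue (S : Finset V) (a : ↥S → R) (b : ↥Sᶜ → R) (x : V) : R :=
  if h : x ∈ S then a ⟨x, h⟩ else b ⟨x, Finset.mem_compl.2 h⟩

theorem dotProduct_glue (S : Finset V) (c : V → R) (a : ↥S → R) (b : ↥Sᶜ → R) :
    c ⬝ᵥ glue S a b = (fun x : ↥S => c x) ⬝ᵥ a + (fun x : ↥Sᶜ => c x) ⬝ᵥ b := by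
  simp only [dotProduct]
  rw [← Finset.sum_add_sum_compl S, ← Finset.sum_coe_sort S, ← Finset.sum_coe_sort Sᶜ]
  congr 1
  · exact Finset.sum_congr rfl fun x _ => by simp [glue]
  · exact Finset.sum_congr rfl fun x _ => by simp [glue, Finset.mem_compl.1 x.2]

/-- The extension by `-X a` of a vector `a` on `S` is sent by `M` to the image of `a` under the
generalized Schur complement, extended by zero. -/
theorem mulVec_glue_neg_mulVec (M : Matrix V V R) (S : Finset V) (X : Matrix ↥Sᶜ ↥S R)
    (hX : M.submatrix (Subtype.val : ↥Sᶜ → V) (Subtype.val : ↥Sᶜ → V) * X =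
      M.submatrix (Subtype.val : ↥Sᶜ → V) (Subtype.val : ↥S → V)) (a : ↥S → R) :
    M *ᵥ glue S a (-(X *ᵥ a)) =
      glue S ((M.submatrix (Subtype.val : ↥S → V) (Subtype.val : ↥S → V) -
        M.submatrix (Subtype.val : ↥S → V) (Subtype.val : ↥Sᶜ → V) * X) *ᵥ a) 0 := by
  ext x
  rw [mulVec, dotProduct_glue, dotProduct_neg, ← sub_eq_add_neg]
  by_cases hx : x ∈ S
  · simp only [glue, hx, dif_pos, sub_mulVec, ← mulVec_mulVec]
    rfl
  · have h := congrFun (congrArg (· *ᵥ a) hX) ⟨x, Finset.mem_compl.2 hx⟩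
    simp only [← mulVec_mulVec] at h
    simp only [glue, hx, dif_neg, not_false_eq_true, Pi.zero_apply]
    exact sub_eq_zero.2 h.symm

end SchurComplement

/-- **The persistent Laplacian preserves effective resistances.**
Let `L` be a connected graph with Laplacian `M = lapMatrix L`, `S` a vertex subset
containing two distinct vertices `v, w`, and `N = Δ₀^{S,L}` the 0-th persistent
Laplacian (the generalized Schur complement of `M(Sᶜ,Sᶜ)` in `M`). With
`d = e_w − e_v` and `d_S` its restriction to `S`, for every `u` with `M·u = d` and
every `u'` with `N·u' = d_S` one has `d ⬝ u = d_S ⬝ u'`: the effective resistance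
between `v` and `w` computed from `N` equals the one computed in `L`. -/
theorem persistent_laplacian_preserves_effective_resistance
    {V : Type*} [Fintype V] [DecidableEq V]
    (L : SimpleGraph V) [DecidableRel L.Adj] (hL : L.Connected)
    (S : Finset V) (v w : V) (hv : v ∈ S) (hw : w ∈ S) (hvw : v ≠ w)
    (X : Matrix ↥Sᶜ ↥S ℝ)
    (hX : (L.lapMatrix ℝ).submatrix (Subtype.val : ↥Sᶜ → V) (Subtype.val : ↥Sᶜ → V) * X =
        (L.lapMatrix ℝ).submatrix (Subtype.val : ↥Sᶜ → V) (Subtype.val : ↥S → V))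
    (N : Matrix ↥S ↥S ℝ)
    (hN : N = (L.lapMatrix ℝ).submatrix (Subtype.val : ↥S → V) (Subtype.val : ↥S → V) -
        (L.lapMatrix ℝ).submatrix (Subtype.val : ↥S → V) (Subtype.val : ↥Sᶜ → V) * X)
    (u : V → ℝ) (hu : (L.lapMatrix ℝ).mulVec u = Pi.single w 1 - Pi.single v 1)
    (u' : ↥S → ℝ)
    (hu' : N.mulVec u' = fun x : ↥S => (Pi.single w 1 - Pi.single v 1 : V → ℝ) x.1) :
    (Pi.single w 1 - Pi.single v 1) ⬝ᵥ u =
      (fun x : ↥S => (Pi.single w 1 - Pi.single v 1 : V → ℝ) x.1) ⬝ᵥ u' := by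
  set d : V → ℝ := Pi.single w 1 - Pi.single v 1 with hd
  have hd0 : ∀ x, x ∉ S → d x = 0 := fun x hx => by
    simp [hd, (ne_of_mem_of_not_mem hv hx).symm, (ne_of_mem_of_not_mem hw hx).symm]
  have hz : L.lapMatrix ℝ *ᵥ glue S u' (-(X *ᵥ u')) = d := by
    rw [mulVec_glue_neg_mulVec _ _ _ hX, ← hN, hu']
    ext x
    by_cases hx : x ∈ S <;> simp [glue, hx, hd0]
  have hdc : (fun x : ↥Sᶜ => d x) = 0 := funext fun x => hd0 x (Finset.mem_compl.1 x.2)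
  calc d ⬝ᵥ u = (L.lapMatrix ℝ *ᵥ glue S u' (-(X *ᵥ u'))) ⬝ᵥ u := by rw [hz]
    _ = d ⬝ᵥ glue S u' (-(X *ᵥ u')) := by
      rw [dotProduct_comm, dotProduct_mulVec, ← mulVec_transpose,
        (L.isSymm_lapMatrix (R := ℝ)).eq, hu]
    _ = (fun x : ↥S => d x) ⬝ᵥ u' := by
      rw [dotProduct_glue, hdc, zero_dotProduct, add_zero]
end
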